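/- Let d₁, d₂, d₃ be pairwise relatively prime integers with 1 < d₁ < d₂ < d₃. Let δ₂ be the unique integer with 0 ≤ δ₂ ≤ d₂ - 1 and d₂ ∣ (d₁ - d₃δ₂), and let δ₃ be the unique integer with 0 ≤ δ₃ ≤ d₃ - 1 and d₃ ∣ (d₁ - d₂δ₃). Then δ₃ d₂ + δ₂ d₃ = d₁ + d₂ d₃. -/

import Mathlib

/-- The key arithmetic identity of Example 3.4: `δ₃ d₂ + δ₂ d₃ = d₁ + d₂ d₃`. -/
theorem stmt_9 (d₁ d₂ d₃ δ₂ δ₃ : ℤ) (h₁ : 1 < d₁) (h₁₂ : d₁ < d₂) (h₂₃ : d₂ < d₃)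
    (hg12 : Int.gcd d₁ d₂ = 1) (hg13 : Int.gcd d₁ d₃ = 1) (hg23 : Int.gcd d₂ d₃ = 1)
    (hδ₂0 : 0 ≤ δ₂) (hδ₂1 : δ₂ ≤ d₂ - 1) (hdvd₂ : d₂ ∣ d₁ - d₃ * δ₂)
    (hδ₃0 : 0 ≤ δ₃) (hδ₃1 : δ₃ ≤ d₃ - 1) (hdvd₃ : d₃ ∣ d₁ - d₂ * δ₃) :
    δ₃ * d₂ + δ₂ * d₃ = d₁ + d₂ * d₃ := by
  have hdvd : d₂ * d₃ ∣ δ₃ * d₂ + δ₂ * d₃ - d₁ := by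
    refine (Int.isCoprime_iff_gcd_eq_one.mpr hg23).mul_dvd ?_ ?_
    · have := (dvd_mul_left d₂ δ₃).sub hdvd₂
      convert this using 1
      ring
    · have := (dvd_mul_left d₃ δ₂).sub hdvd₃
      convert this using 1
      ring
  obtain ⟨k, hk⟩ := hdvd
  have hd₂ : 0 < d₂ := by linarith
  have hd₃ : 0 < d₃ := by linarith
  have hk_pos : 0 < k := by
    by_contra! hk0
    have hle : δ₃ * d₂ + δ₂ * d₃ ≤ d₁ := by
      nlinarith [mul_nonneg (mul_pos hd₂ hd₃).le (neg_nonneg.mpr hk0)]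
    have hδ₂ : δ₂ = 0 := by
      by_contra hne
      have : 1 ≤ δ₂ := by omega
      nlinarith [mul_nonneg hδ₃0 hd₂.le]
    subst hδ₂
    have := Int.le_of_dvd (by linarith) hdvd₂
    linarith
  have hk_lt : k < 2 := by
    by_contra! hk2
    nlinarith [mul_le_mul_of_nonneg_left hk2 (mul_pos hd₂ hd₃).le,
      mul_le_mul_of_nonneg_right hδ₃1 hd₂.le, mul_le_mul_of_nonneg_right hδ₂1 hd₃.le]
  obtain rfl : k = 1 := by omega
  linarith
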